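/- arXiv:math/0308193 — 2 statements merged into one kernel-verified Lean document; each statement's English description precedes it below -/
import Mathlib

section
/- (Brascamp–Lebowitz–Lieb type lower bound.) Let n ≥ 1, let H ∈ C¹(ℝⁿ, ℝ) with Z = ∫_{ℝⁿ} e^{−H(x)} dx < ∞, and let μ = Z^{-1} e^{−H(x)} dx be the associated Gibbs probability measure. Assume that the functions x ↦ x_i x_j and x ↦ ∂_iH(x) ∂_jH(x) are μ-integrable for all i, j, and that the integration-by-parts identities ∫ x_i ∂_jH dμ = δ_{ij} hold for all i, j. Let M be the n×n matrix with entries M_{ij} = ∫ ∂_iH ∂_jH dμ, and assume M ≥ κ·Id_n for some κ > 0 (in particular M is invertible). Then for every f ∈ ℝⁿ: ∫ ⟨f, x⟩² dμ(x) ≥ ⟨f, M^{-1} f⟩. -/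
open MeasureTheory Filter Topology Matrix

noncomputable section

/-- Expectation of the product of two linear forms in square-integrable coordinates. -/
theorem integral_dotProduct_mul_dotProduct {Ω ι : Type*} [Fintype ι] [MeasurableSpace Ω]
    {μ : Measure Ω} {X Y : Ω → ι → ℝ} (hX : ∀ i, MemLp (fun ω => X ω i) 2 μ)
    (hY : ∀ i, MemLp (fun ω => Y ω i) 2 μ) (f g : ι → ℝ) :
    ∫ ω, (f ⬝ᵥ X ω) * (g ⬝ᵥ Y ω) ∂μ
      = f ⬝ᵥ (Matrix.of fun i j => ∫ ω, X ω i * Y ω j ∂μ) *ᵥ g := by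
  have hint (i j : ι) : Integrable (fun ω => f i * g j * (X ω i * Y ω j)) μ :=
    ((hX i).integrable_mul (hY j)).const_mul _
  have hexp (ω : Ω) : (f ⬝ᵥ X ω) * (g ⬝ᵥ Y ω) = ∑ i, ∑ j, f i * g j * (X ω i * Y ω j) := by
    simp only [dotProduct, Finset.sum_mul_sum]
    exact Finset.sum_congr rfl fun i _ => Finset.sum_congr rfl fun j _ => by ring
  simp only [hexp]
  rw [integral_finsetSum _ fun i _ => integrable_finsetSum _ fun j _ => hint i j]
  simp only [dotProduct, mulVec, Finset.mul_sum, Matrix.of_apply]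
  refine Finset.sum_congr rfl fun i _ => ?_
  rw [integral_finsetSum _ fun j _ => hint i j]
  refine Finset.sum_congr rfl fun j _ => ?_
  rw [integral_const_mul]
  ring

/-- A linear form in square-integrable coordinates is square-integrable. -/
theorem memLp_two_dotProduct {Ω ι : Type*} [Fintype ι] [MeasurableSpace Ω]
    {μ : Measure Ω} {X : Ω → ι → ℝ} (hX : ∀ i, MemLp (fun ω => X ω i) 2 μ) (f : ι → ℝ) :
    MemLp (fun ω => f ⬝ᵥ X ω) 2 μ :=
  memLp_finsetSum _ fun i _ => (hX i).const_mul (f i)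

/-- If `X` and `Y` are biorthogonal in `L²(μ)` and the Gram matrix of `Y` is invertible, then the
covariance form of `X` dominates the inverse of that Gram matrix. -/
theorem dotProduct_inv_mulVec_le_integral_sq {Ω ι : Type*} [Fintype ι] [DecidableEq ι]
    [MeasurableSpace Ω] {μ : Measure Ω} {X Y : Ω → ι → ℝ}
    (hX : ∀ i, MemLp (fun ω => X ω i) 2 μ) (hY : ∀ i, MemLp (fun ω => Y ω i) 2 μ)
    (hXY : (Matrix.of fun i j => ∫ ω, X ω i * Y ω j ∂μ) = 1)
    {M : Matrix ι ι ℝ} (hM : (Matrix.of fun i j => ∫ ω, Y ω i * Y ω j ∂μ) = M)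
    (hdet : IsUnit M.det) (f : ι → ℝ) :
    f ⬝ᵥ M⁻¹ *ᵥ f ≤ ∫ ω, (f ⬝ᵥ X ω) ^ 2 ∂μ := by
  set g := M⁻¹ *ᵥ f with hg
  have hMg : M *ᵥ g = f := by
    rw [hg, mulVec_mulVec, Matrix.mul_nonsing_inv _ hdet, one_mulVec]
  have hfX := memLp_two_dotProduct hX f
  have hgY := memLp_two_dotProduct hY g
  have hcross : ∫ ω, (f ⬝ᵥ X ω) * (g ⬝ᵥ Y ω) ∂μ = f ⬝ᵥ g := by
    rw [integral_dotProduct_mul_dotProduct hX hY, hXY, one_mulVec]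
  have hsq : ∫ ω, (g ⬝ᵥ Y ω) ^ 2 ∂μ = f ⬝ᵥ g := by
    simp only [sq]
    rw [integral_dotProduct_mul_dotProduct hY hY, hM, hMg, dotProduct_comm]
  have hnonneg : 0 ≤ ∫ ω, (f ⬝ᵥ X ω - g ⬝ᵥ Y ω) ^ 2 ∂μ :=
    integral_nonneg fun ω => sq_nonneg _
  have hmul : Integrable (fun ω => 2 * ((f ⬝ᵥ X ω) * (g ⬝ᵥ Y ω))) μ :=
    (hfX.integrable_mul hgY).const_mul 2
  have hexpand (ω : Ω) : (f ⬝ᵥ X ω - g ⬝ᵥ Y ω) ^ 2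
      = (f ⬝ᵥ X ω) ^ 2 - 2 * ((f ⬝ᵥ X ω) * (g ⬝ᵥ Y ω)) + (g ⬝ᵥ Y ω) ^ 2 := by ring
  have hdiff : Integrable (fun ω => (f ⬝ᵥ X ω) ^ 2 - 2 * ((f ⬝ᵥ X ω) * (g ⬝ᵥ Y ω))) μ :=
    hfX.integrable_sq.sub hmul
  simp only [hexpand] at hnonneg
  rw [integral_add hdiff hgY.integrable_sq,
    integral_sub hfX.integrable_sq hmul, integral_const_mul, hcross, hsq] at hnonneg
  linarith

/-- A real square matrix whose quadratic form is coercive is invertible. -/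
theorem isUnit_det_of_coercive {ι : Type*} [Fintype ι] [DecidableEq ι] {M : Matrix ι ι ℝ}
    {κ : ℝ} (hκ : 0 < κ) (hMκ : ∀ v : ι → ℝ, κ * ∑ i, v i ^ 2 ≤ v ⬝ᵥ M *ᵥ v) :
    IsUnit M.det := by
  rw [isUnit_iff_ne_zero]
  intro hdet
  obtain ⟨v, hv, hMv⟩ := Matrix.exists_mulVec_eq_zero_iff.mpr hdet
  have hle := hMκ v
  rw [hMv, dotProduct_zero] at hle
  obtain ⟨i, hi⟩ := Function.ne_iff.mp hv
  have hpos : 0 < ∑ i, v i ^ 2 :=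
    Finset.sum_pos' (fun j _ => sq_nonneg (v j)) ⟨i, Finset.mem_univ i, sq_pos_of_ne_zero hi⟩
  exact absurd hle (not_le.mpr (mul_pos hκ hpos))

/-- Brascamp–Lebowitz–Lieb type lower bound: Let `H ∈ C¹(ℝⁿ, ℝ)` with
`Z = ∫ e^{-H} < ∞` and Gibbs measure `μ = Z⁻¹ e^{-H} dx`. Assume `x_i x_j` and
`∂_iH ∂_jH` are `μ`-integrable, the integration-by-parts identities
`∫ x_i ∂_jH dμ = δ_{ij}` hold, and the matrix `M_{ij} = ∫ ∂_iH ∂_jH dμ` satisfies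
`M ≥ κ·Id` for some `κ > 0`. Then `∫ ⟨f, x⟩² dμ ≥ ⟨f, M⁻¹ f⟩` for all `f ∈ ℝⁿ`. -/
theorem statement_11 (n : ℕ) (hn : 1 ≤ n)
    (H : (Fin n → ℝ) → ℝ) (hC1 : ContDiff ℝ 1 H)
    (hZ : Integrable fun x : Fin n → ℝ => Real.exp (-H x))
    (μ : Measure (Fin n → ℝ))
    (hμ : μ = (ENNReal.ofReal (∫ x : Fin n → ℝ, Real.exp (-H x)))⁻¹ •
      volume.withDensity fun x => ENNReal.ofReal (Real.exp (-H x)))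
    (pd : (Fin n → ℝ) → Fin n → ℝ)
    (hpd : ∀ x i, pd x i = fderiv ℝ H x (Pi.single i 1))
    (hxx : ∀ i j, Integrable (fun x => x i * x j) μ)
    (hHH : ∀ i j, Integrable (fun x => pd x i * pd x j) μ)
    (hIBP : ∀ i j, ∫ x, x i * pd x j ∂μ = if i = j then (1 : ℝ) else 0)
    (M : Matrix (Fin n) (Fin n) ℝ)
    (hM : ∀ i j, M i j = ∫ x, pd x i * pd x j ∂μ)
    (κ : ℝ) (hκ : 0 < κ)
    (hMκ : ∀ v : Fin n → ℝ, κ * ∑ i, v i ^ 2 ≤ v ⬝ᵥ M.mulVec v) :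
    ∀ f : Fin n → ℝ, f ⬝ᵥ M⁻¹.mulVec f ≤ ∫ x, (∑ i, f i * x i) ^ 2 ∂μ := by
  intro f
  have hcont (i : Fin n) : Continuous fun x => pd x i := by
    simp only [hpd]
    exact (hC1.continuous_fderiv one_ne_zero).clm_apply continuous_const
  have hX (i : Fin n) : MemLp (fun x : Fin n → ℝ => x i) 2 μ :=
    (memLp_two_iff_integrable_sq (continuous_apply i).aestronglyMeasurable).mpr <| by
      simpa only [sq] using hxx i i
  have hY (i : Fin n) : MemLp (fun x => pd x i) 2 μ :=
    (memLp_two_iff_integrable_sq (hcont i).aestronglyMeasurable).mpr <| by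
      simpa only [sq] using hHH i i
  refine dotProduct_inv_mulVec_le_integral_sq (X := fun x => x) hX hY ?_ ?_
    (isUnit_det_of_coercive hκ hMκ) f
  · ext i j
    rw [Matrix.of_apply, hIBP, Matrix.one_apply]
  · ext i j
    rw [Matrix.of_apply, hM]
end
end

section
/- Let K: ℝ → ℝ be an even measurable function with ∫_ℝ (1 + t²)|K(t)| dt < ∞, and define its Fourier transform K̂(ω) = ∫_ℝ cos(ωt) K(t) dt (which is real since K is even). Then, with D₀ = 2∫_ℝ (1 + t²)|K(t)| dt, for all ω ∈ ℝ: K̂(0) − K̂(ω) ≤ D₀ · ω²/(1 + ω²). -/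
open MeasureTheory Filter Topology

noncomputable section

theorem one_sub_cos_mul_le (w t : ℝ) :
    1 - Real.cos (w * t) ≤ 2 * (w ^ 2 / (1 + w ^ 2)) * (1 + t ^ 2) := by
  have h₁ := Real.one_sub_sq_div_two_le_cos (x := w * t)
  have h₂ := Real.neg_one_le_cos (w * t)
  have hw : 0 < 1 + w ^ 2 := by positivity
  rw [← mul_div_assoc, div_mul_eq_mul_div, le_div_iff₀ hw]
  nlinarith [mul_nonneg (sq_nonneg w) (by linarith : 0 ≤ 1 + Real.cos (w * t)),
    sq_nonneg (w * t)]

/-- Let `K : ℝ → ℝ` be even and measurable with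
`∫ (1 + t²)|K(t)| dt < ∞`, and let `K̂(ω) = ∫ cos(ωt) K(t) dt` be its (cosine) Fourier
transform. Then, with `D₀ = 2∫ (1 + t²)|K(t)| dt`, for all `ω ∈ ℝ`:
`K̂(0) - K̂(ω) ≤ D₀ ω²/(1 + ω²)`. -/
theorem statement_13 (K : ℝ → ℝ) (hmeas : Measurable K)
    (heven : ∀ t, K (-t) = K t)
    (hint : Integrable fun t => (1 + t ^ 2) * |K t|)
    (Khat : ℝ → ℝ) (hKhat : ∀ w, Khat w = ∫ t, Real.cos (w * t) * K t)
    (D₀ : ℝ) (hD₀ : D₀ = 2 * ∫ t, (1 + t ^ 2) * |K t|) :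
    ∀ w : ℝ, Khat 0 - Khat w ≤ D₀ * w ^ 2 / (1 + w ^ 2) := by
  intro w
  have hK : Integrable K := by
    refine hint.mono' hmeas.aestronglyMeasurable (ae_of_all _ fun t => ?_)
    rw [Real.norm_eq_abs]
    nlinarith [mul_nonneg (sq_nonneg t) (abs_nonneg (K t))]
  have hcos (v : ℝ) : Integrable fun t => Real.cos (v * t) * K t :=
    hK.bdd_mul (c := 1) (by fun_prop) (ae_of_all _ fun t => Real.abs_cos_le_one _)
  calc Khat 0 - Khat w
      = ∫ t, (Real.cos (0 * t) * K t - Real.cos (w * t) * K t) := by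
        rw [hKhat, hKhat, integral_sub (hcos 0) (hcos w)]
    _ ≤ ∫ t, 2 * (w ^ 2 / (1 + w ^ 2)) * ((1 + t ^ 2) * |K t|) := by
        refine integral_mono ((hcos 0).sub (hcos w)) (hint.const_mul _) fun t => ?_
        calc Real.cos (0 * t) * K t - Real.cos (w * t) * K t
            = (1 - Real.cos (w * t)) * K t := by rw [zero_mul, Real.cos_zero]; ring
          _ ≤ (1 - Real.cos (w * t)) * |K t| :=
            mul_le_mul_of_nonneg_left (le_abs_self _) (sub_nonneg.2 (Real.cos_le_one _))
          _ ≤ 2 * (w ^ 2 / (1 + w ^ 2)) * (1 + t ^ 2) * |K t| :=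
            mul_le_mul_of_nonneg_right (one_sub_cos_mul_le w t) (abs_nonneg _)
          _ = 2 * (w ^ 2 / (1 + w ^ 2)) * ((1 + t ^ 2) * |K t|) := mul_assoc _ _ _
    _ = D₀ * w ^ 2 / (1 + w ^ 2) := by
        rw [integral_const_mul, hD₀]; ring
end
end
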